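/- arXiv:2011.00276 — 3 statements merged into one kernel-verified Lean document; each statement's English description precedes it below -/
import Mathlib

section
/- Sharp Gagliardo–Nirenberg inequality on the line with critical exponent 6: for every function u in H¹(ℝ), one has ∫_ℝ |u|⁶ dx ≤ (4/π²) (∫_ℝ u² dx)² (∫_ℝ |u'|² dx). (Equivalently, the optimal constant C₆(ℝ) equals 3/μ_ℝ², where μ_ℝ = π√3/2 is the critical mass of the line.) -/
open MeasureTheory Real Set Filter

/-- Membership in `H¹(ℝ)`: `u` is differentiable with derivative `u'`,
and both `u` and `u'` are square-integrable on `ℝ`. -/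
def H1line (u u' : ℝ → ℝ) : Prop :=
  (∀ x, HasDerivAt u (u' x) x) ∧
  Integrable (fun x => (u x) ^ 2) ∧
  Integrable (fun x => (u' x) ^ 2)

open scoped Topology

namespace H1line

variable {u u' : ℝ → ℝ}

theorem continuous (h : H1line u u') : Continuous u :=
  continuous_iff_continuousAt.2 fun x => (h.1 x).continuousAt

theorem measurable_deriv (h : H1line u u') : Measurable u' := by
  have : u' = deriv u := funext fun x => (h.1 x).deriv.symm
  exact this ▸ _root_.measurable_deriv u

theorem integrable_mul_deriv (h : H1line u u') : Integrable (fun x => u x * u' x) := by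
  refine (h.2.1.add h.2.2).mono'
    (h.continuous.measurable.mul h.measurable_deriv).aestronglyMeasurable (.of_forall fun x => ?_)
  simp only [Pi.add_apply, norm_eq_abs, abs_le]
  constructor <;> nlinarith [sq_nonneg (u x + u' x), sq_nonneg (u x - u' x)]

theorem hasDerivAt_sq (h : H1line u u') (x : ℝ) :
    HasDerivAt (fun x => u x ^ 2) (2 * (u x * u' x)) x := by
  refine ((h.1 x).fun_pow 2).congr_deriv ?_
  simp [mul_assoc]

theorem tendsto_sq_atTop (h : H1line u u') : Tendsto (fun x => u x ^ 2) atTop (𝓝 0) :=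
  tendsto_zero_of_hasDerivAt_of_integrableOn_Ioi (a := 0) (fun x _ => h.hasDerivAt_sq x)
    (h.integrable_mul_deriv.const_mul 2).integrableOn h.2.1.integrableOn

theorem tendsto_sq_atBot (h : H1line u u') : Tendsto (fun x => u x ^ 2) atBot (𝓝 0) :=
  tendsto_zero_of_hasDerivAt_of_integrableOn_Iic (a := 0) (fun x _ => h.hasDerivAt_sq x)
    (h.integrable_mul_deriv.const_mul 2).integrableOn h.2.1.integrableOn

theorem exists_sq_le (h : H1line u u') : ∃ B, ∀ x, u x ^ 2 ≤ B := by
  let f : ZeroAtInftyContinuousMap ℝ ℝ :=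
    { toFun := fun x => u x ^ 2
      continuous_toFun := h.continuous.pow 2
      zero_at_infty' := by
        rw [cocompact_eq_atBot_atTop]
        exact h.tendsto_sq_atBot.sup h.tendsto_sq_atTop }
  obtain ⟨B, hB⟩ := f.isBounded_range.exists_norm_le
  exact ⟨B, fun x => (le_abs_self _).trans (hB _ ⟨x, rfl⟩)⟩

theorem integrable_pow_six (h : H1line u u') : Integrable (fun x => u x ^ 6) := by
  obtain ⟨B, hB⟩ := h.exists_sq_le
  have := h.2.1.bdd_mul (c := B ^ 2) (f := fun x => u x ^ 4)
    (h.continuous.pow 4).aestronglyMeasurable (.of_forall fun x => by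
      rw [norm_of_nonneg (by positivity)]
      nlinarith [hB x, sq_nonneg (u x)])
  exact this.congr (.of_forall fun x => by ring)

/-- The mass of `u` to the left of `x` is a primitive of `u ^ 2`. -/
theorem hasDerivAt_integral_Iic (h : H1line u u') (x : ℝ) :
    HasDerivAt (fun y => ∫ t in Iic y, u t ^ 2) (u x ^ 2) x := by
  have hc : Continuous fun x => u x ^ 2 := h.continuous.pow 2
  have hd := (intervalIntegral.integral_hasDerivAt_right (a := 0) (b := x)
    h.2.1.intervalIntegrable (hc.stronglyMeasurableAtFilter _ _) hc.continuousAt).const_add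
    (∫ t in Iic 0, u t ^ 2)
  refine hd.congr_of_eventuallyEq (.of_forall fun y => ?_)
  have := intervalIntegral.integral_Iic_sub_Iic (a := 0) (b := y)
    h.2.1.integrableOn h.2.1.integrableOn
  linarith

/-- If `θ' = k u ^ 2` and `θ` stays in a compact subinterval of `(0, π)`, completing the square
against `cot θ` bounds `∫ u ^ 6`. -/
theorem integral_pow_six_le_of_angle (h : H1line u u') {θ : ℝ → ℝ} {k δ : ℝ} (hδ : 0 < δ)
    (hθ : ∀ x, HasDerivAt θ (k * u x ^ 2) x) (hmem : ∀ x, θ x ∈ Icc δ (π - δ)) :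
    k ^ 2 / 4 * ∫ x, u x ^ 6 ≤ ∫ x, u' x ^ 2 := by
  have hsin : ∀ t ∈ Icc δ (π - δ), sin t ≠ 0 := fun t ht =>
    (sin_pos_of_pos_of_lt_pi (by linarith [ht.1]) (by linarith [ht.2])).ne'
  obtain ⟨C, hC⟩ := isCompact_Icc.exists_bound_of_continuousOn
    (continuousOn_cos.div continuousOn_sin hsin)
  obtain ⟨B, hB⟩ := h.exists_sq_le
  set c : ℝ → ℝ := fun x => cos (θ x) / sin (θ x) with hc
  have hcC : ∀ x, |c x| ≤ C := fun x => hC _ (hmem x)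
  have hs : ∀ x, sin (θ x) ≠ 0 := fun x => hsin _ (hmem x)
  have hcd : ∀ x, HasDerivAt c (-(1 + c x ^ 2) * (k * u x ^ 2)) x := fun x => by
    refine ((hθ x).cos.fun_div (hθ x).sin (hs x)).congr_deriv ?_
    have := hs x
    simp only [hc]
    field_simp
    ring
  have hcc : Continuous c := continuous_iff_continuousAt.2 fun x => (hcd x).continuousAt
  have hGd : ∀ x, HasDerivAt (fun x => k / 4 * ((u x ^ 2) ^ 2 * c x))
      (k * (u x ^ 2 * c x * (u x * u' x)) - k ^ 2 / 4 * ((1 + c x ^ 2) * u x ^ 6)) x := fun x => by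
    refine ((((h.hasDerivAt_sq x).fun_pow 2).fun_mul (hcd x)).const_mul (k / 4)).congr_deriv ?_
    simp
    ring
  have hB0 : 0 ≤ B := (sq_nonneg _).trans (hB 0)
  have hint₁ : Integrable (fun x => u x ^ 2 * c x * (u x * u' x)) := by
    refine h.integrable_mul_deriv.bdd_mul (c := B * C)
      ((h.continuous.pow 2).mul hcc).aestronglyMeasurable (.of_forall fun x => ?_)
    rw [norm_mul, norm_of_nonneg (sq_nonneg (u x)), norm_eq_abs]
    exact mul_le_mul (hB x) (hcC x) (abs_nonneg _) hB0
  have hint₂ : Integrable (fun x => (1 + c x ^ 2) * u x ^ 6) := by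
    refine h.integrable_pow_six.bdd_mul (c := 1 + C ^ 2)
      (continuous_const.add (hcc.pow 2)).aestronglyMeasurable (.of_forall fun x => ?_)
    rw [norm_of_nonneg (by positivity)]
    linarith [sq_le_sq.2 ((hcC x).trans (le_abs_self C))]
  have hint : Integrable (fun x =>
      k * (u x ^ 2 * c x * (u x * u' x)) - k ^ 2 / 4 * ((1 + c x ^ 2) * u x ^ 6)) :=
    (hint₁.const_mul k).sub (hint₂.const_mul (k ^ 2 / 4))
  have hlim : ∀ l : Filter ℝ, Tendsto (fun x => u x ^ 2) l (𝓝 0) →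
      Tendsto (fun x => k / 4 * ((u x ^ 2) ^ 2 * c x)) l (𝓝 0) := fun l hl => by
    have h0 : Tendsto (fun x => (u x ^ 2) ^ 2 * c x) l (𝓝 0) := by
      refine Tendsto.zero_mul_isBoundedUnder_le (by simpa using hl.pow 2)
        (isBoundedUnder_of ⟨C, hcC⟩)
    simpa using h0.const_mul (k / 4)
  have hzero := integral_of_hasDerivAt_of_tendsto hGd hint
    (hlim _ h.tendsto_sq_atBot) (hlim _ h.tendsto_sq_atTop)
  calc k ^ 2 / 4 * ∫ x, u x ^ 6
      = ∫ x, (k ^ 2 / 4 * u x ^ 6 +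
          (k * (u x ^ 2 * c x * (u x * u' x)) - k ^ 2 / 4 * ((1 + c x ^ 2) * u x ^ 6))) := by
        rw [integral_add (h.integrable_pow_six.const_mul _) hint, hzero, integral_const_mul]
        simp
    _ ≤ ∫ x, u' x ^ 2 := by
        refine integral_mono ((h.integrable_pow_six.const_mul _).add hint) h.2.2 fun x => ?_
        have := sq_nonneg (u' x - k / 2 * u x ^ 3 * c x)
        simp only
        linarith

theorem pi_sq_mul_integral_pow_six_le (h : H1line u u') {ε : ℝ} (hε : 0 < ε) :
    π ^ 2 * ∫ x, u x ^ 6 ≤ 4 * ((∫ x, u x ^ 2) + 2 * ε) ^ 2 * ∫ x, u' x ^ 2 := by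
  set M := ∫ x, u x ^ 2
  have hM : 0 ≤ M := integral_nonneg fun x => sq_nonneg _
  have hM' : 0 < M + 2 * ε := by linarith
  set k := π / (M + 2 * ε)
  have hk0 : 0 < k := div_pos pi_pos hM'
  have hkπ : k * (M + 2 * ε) = π := div_mul_cancel₀ _ hM'.ne'
  have key := h.integral_pow_six_le_of_angle (k := k) (δ := k * ε)
    (θ := fun x => k * (ε + ∫ t in Iic x, u t ^ 2)) (mul_pos hk0 hε)
    (fun x => ((h.hasDerivAt_integral_Iic x).const_add ε).const_mul k) fun x => by
      have h0 : 0 ≤ ∫ t in Iic x, u t ^ 2 := integral_nonneg fun x => sq_nonneg _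
      have h1 : ∫ t in Iic x, u t ^ 2 ≤ M :=
        setIntegral_le_integral h.2.1 (.of_forall fun x => sq_nonneg _)
      constructor <;> nlinarith
  calc π ^ 2 * ∫ x, u x ^ 6
      = 4 * (M + 2 * ε) ^ 2 * (k ^ 2 / 4 * ∫ x, u x ^ 6) := by rw [← hkπ]; ring
    _ ≤ _ := mul_le_mul_of_nonneg_left key (by positivity)

end H1line

/-- Sharp Gagliardo–Nirenberg inequality on the line with critical exponent 6:
for every `u ∈ H¹(ℝ)`, `∫ |u|⁶ ≤ (4/π²) (∫ u²)² (∫ |u'|²)`. -/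
theorem sharp_gagliardo_nirenberg_line (u u' : ℝ → ℝ) (h : H1line u u') :
    (∫ x, |u x| ^ 6) ≤ 4 / Real.pi ^ 2 * (∫ x, (u x) ^ 2) ^ 2 * ∫ x, (u' x) ^ 2 := by
  have hlim : Tendsto (fun ε : ℝ => 4 * ((∫ x, u x ^ 2) + 2 * ε) ^ 2 * ∫ x, u' x ^ 2) (𝓝[>] 0)
      (𝓝 (4 * ((∫ x, u x ^ 2) + 2 * 0) ^ 2 * ∫ x, u' x ^ 2)) :=
    (Continuous.tendsto (by fun_prop) 0).mono_left nhdsWithin_le_nhds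
  have key := ge_of_tendsto hlim (eventually_mem_nhdsWithin.mono fun ε hε =>
    h.pi_sq_mul_integral_pow_six_le hε)
  have habs : ∀ x, |u x| ^ 6 = u x ^ 6 := fun x => Even.pow_abs (by decide) _
  simp only [habs]
  rw [mul_zero, add_zero] at key
  rw [div_mul_eq_mul_div, div_mul_eq_mul_div, le_div_iff₀ (by positivity), mul_comm]
  exact key
end

section
/- Sharp Gagliardo–Nirenberg inequality on the half-line with critical exponent 6: for every function u in H¹(ℝ⁺), one has ∫₀^∞ |u|⁶ dx ≤ (16/π²) (∫₀^∞ u² dx)² (∫₀^∞ |u'|² dx). (Equivalently, the optimal constant C₆(ℝ⁺) equals 3/μ_{ℝ⁺}², where μ_{ℝ⁺} = π√3/4 is the critical mass of the half-line.) -/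
open MeasureTheory Real Set Filter

/-- Membership in `H¹(ℝ⁺)`: `u` is continuous on `[0,∞)`, differentiable on `(0,∞)`
with derivative `u'`, and both `u` and `u'` are square-integrable on `(0,∞)`. -/
def H1halfline (u u' : ℝ → ℝ) : Prop :=
  ContinuousOn u (Set.Ici 0) ∧
  (∀ x ∈ Set.Ioi (0 : ℝ), HasDerivAt u (u' x) x) ∧
  IntegrableOn (fun x => (u x) ^ 2) (Set.Ioi 0) ∧
  IntegrableOn (fun x => (u' x) ^ 2) (Set.Ioi 0)

section HalfLine

variable {v v' : ℝ → ℝ}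

lemma aestronglyMeasurable_of_hasDerivAt_Ioi {a : ℝ}
    (hd : ∀ x ∈ Ioi a, HasDerivAt v (v' x) x) :
    AEStronglyMeasurable v' (volume.restrict (Ioi a)) :=
  (stronglyMeasurable_deriv v).aestronglyMeasurable.congr <|
    (ae_restrict_iff' measurableSet_Ioi).2 <| .of_forall fun x hx => (hd x hx).deriv

lemma integrableOn_mul_of_sq {s : Set ℝ} {f g : ℝ → ℝ}
    (hfm : AEStronglyMeasurable f (volume.restrict s))
    (hgm : AEStronglyMeasurable g (volume.restrict s))
    (hf : IntegrableOn (fun x => f x ^ 2) s) (hg : IntegrableOn (fun x => g x ^ 2) s) :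
    IntegrableOn (fun x => f x * g x) s :=
  ((memLp_two_iff_integrable_sq hfm).2 hf).integrable_mul
    ((memLp_two_iff_integrable_sq hgm).2 hg)

lemma tendsto_sq_atTop_zero (hc : Continuous v)
    (hd : ∀ x ∈ Ioi (0 : ℝ), HasDerivAt v (v' x) x)
    (hv : IntegrableOn (fun x => v x ^ 2) (Ioi 0))
    (hv' : IntegrableOn (fun x => v' x ^ 2) (Ioi 0)) :
    Tendsto (fun x => v x ^ 2) atTop (nhds 0) := by
  refine tendsto_zero_of_hasDerivAt_of_integrableOn_Ioi (a := 0)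
    (f' := fun x => 2 * (v x * v' x)) (fun x hx => ?_) ?_ hv
  · exact ((hd x hx).pow 2).congr_deriv (by ring)
  · exact (integrableOn_mul_of_sq hc.aestronglyMeasurable
      (aestronglyMeasurable_of_hasDerivAt_Ioi hd) hv hv').const_mul 2

lemma exists_sq_le_of_tendsto (hc : Continuous v)
    (ht : Tendsto (fun x => v x ^ 2) atTop (nhds 0)) :
    ∃ B : ℝ, ∀ x ∈ Ioi (0 : ℝ), v x ^ 2 ≤ B := by
  obtain ⟨R, hR⟩ := eventually_atTop.1 (ht.eventually (gt_mem_nhds one_pos))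
  obtain ⟨C, hC⟩ := (isCompact_Icc (a := (0 : ℝ)) (b := R)).bddAbove_image
    (f := fun x => v x ^ 2) (by fun_prop)
  refine ⟨max C 1, fun x hx => ?_⟩
  rcases le_total x R with h | h
  · exact (hC ⟨x, ⟨le_of_lt hx, h⟩, rfl⟩).trans (le_max_left _ _)
  · exact (hR x h).le.trans (le_max_right _ _)

/-- The Wirtinger inequality on `(0, M)` with a Dirichlet condition at `M`, in the variable
`s = ∫₀ˣ v²`, proved by completing a square with `tan (k s)`. -/
lemma sq_mul_integral_pow_six_le (hc : Continuous v)
    (hd : ∀ x ∈ Ioi (0 : ℝ), HasDerivAt v (v' x) x)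
    (hv : IntegrableOn (fun x => v x ^ 2) (Ioi 0))
    (hv' : IntegrableOn (fun x => v' x ^ 2) (Ioi 0))
    {k : ℝ} (hk : 0 < k) (hkM : k * ∫ x in Ioi (0 : ℝ), v x ^ 2 < π / 2) :
    k ^ 2 * ∫ x in Ioi (0 : ℝ), v x ^ 6 ≤ 4 * ∫ x in Ioi (0 : ℝ), v' x ^ 2 := by
  have hlim := tendsto_sq_atTop_zero hc hd hv hv'
  obtain ⟨B, hB⟩ := exists_sq_le_of_tendsto hc hlim
  have hB0 : 0 ≤ B := (sq_nonneg _).trans (hB 1 (mem_Ioi.2 one_pos))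
  set M := ∫ x in Ioi (0 : ℝ), v x ^ 2 with hM
  have hM0 : 0 ≤ M := integral_nonneg fun x => sq_nonneg _
  set S : ℝ → ℝ := fun x => ∫ t in (0 : ℝ)..x, v t ^ 2 with hS
  have hS_deriv (x : ℝ) : HasDerivAt S (v x ^ 2) x :=
    (hc.pow 2).integral_hasStrictDerivAt 0 x |>.hasDerivAt
  have hS_cont : Continuous S := continuous_iff_continuousAt.2 fun x => (hS_deriv x).continuousAt
  have hS_mem (x : ℝ) (hx : 0 ≤ x) : 0 ≤ S x ∧ S x ≤ M := by
    refine ⟨intervalIntegral.integral_nonneg hx fun t _ => sq_nonneg _, ?_⟩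
    rw [hS, hM]
    simp only [intervalIntegral.integral_of_le hx]
    exact setIntegral_mono_set hv (.of_forall fun t => sq_nonneg _)
      Ioc_subset_Ioi_self.eventuallyLE
  have hkS (x : ℝ) (hx : 0 ≤ x) : 0 ≤ k * S x ∧ k * S x ≤ k * M :=
    ⟨mul_nonneg hk.le (hS_mem x hx).1, mul_le_mul_of_nonneg_left (hS_mem x hx).2 hk.le⟩
  have hcos (x : ℝ) (hx : 0 ≤ x) : cos (k * S x) ≠ 0 :=
    (cos_pos_of_mem_Ioo ⟨by linarith [(hkS x hx).1, pi_pos], by linarith [(hkS x hx).2]⟩).ne'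
  set T : ℝ → ℝ := fun x => tan (k * S x) with hT
  have hT0 (x : ℝ) (hx : 0 ≤ x) : 0 ≤ T x :=
    tan_nonneg_of_nonneg_of_le_pi_div_two (hkS x hx).1 (by linarith [(hkS x hx).2])
  have hT_le (x : ℝ) (hx : 0 ≤ x) : T x ≤ tan (k * M) :=
    strictMonoOn_tan.monotoneOn ⟨by linarith [(hkS x hx).1, pi_pos], by linarith [(hkS x hx).2]⟩
      ⟨by linarith [mul_nonneg hk.le hM0, pi_pos], hkM⟩ (hkS x hx).2
  have hT_abs (x : ℝ) (hx : 0 ≤ x) : |T x| ≤ tan (k * M) :=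
    (abs_of_nonneg (hT0 x hx)).trans_le (hT_le x hx)
  have hT_deriv (x : ℝ) (hx : 0 ≤ x) : HasDerivAt T (k * v x ^ 2 * (1 + T x ^ 2)) x := by
    refine ((hasDerivAt_tan (hcos x hx)).comp x ((hS_deriv x).const_mul k)).congr_deriv ?_
    rw [hT, ← inv_one_add_tan_sq (hcos x hx), one_div, inv_inv]
    ring
  have hT_meas : Measurable T := by
    have : T = fun x => sin (k * S x) / cos (k * S x) := funext fun x => tan_eq_sin_div_cos _
    rw [this]
    have := hS_cont.measurable
    fun_prop
  have hv'_meas := aestronglyMeasurable_of_hasDerivAt_Ioi hd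
  have h_ae {p : ℝ → Prop} (hp : ∀ x ∈ Ioi (0 : ℝ), p x) : ∀ᵐ x ∂volume.restrict (Ioi 0), p x :=
    (ae_restrict_iff' measurableSet_Ioi).2 (.of_forall hp)
  have h_six : IntegrableOn (fun x => v x ^ 6) (Ioi 0) := by
    refine (hv.bdd_mul (f := fun x => v x ^ 4) (c := B ^ 2)
      (hc.pow 4).aestronglyMeasurable (h_ae fun x hx => ?_)).congr (.of_forall fun x => by
        simp only; ring)
    rw [norm_of_nonneg (by positivity), show v x ^ 4 = (v x ^ 2) ^ 2 by ring]
    exact pow_le_pow_left₀ (sq_nonneg _) (hB x hx) 2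
  have h_cross : IntegrableOn (fun x => T x * (v x ^ 3 * v' x)) (Ioi 0) := by
    refine ((integrableOn_mul_of_sq hc.aestronglyMeasurable hv'_meas hv hv').bdd_mul
      (f := fun x => T x * v x ^ 2) (c := tan (k * M) * B)
      (hT_meas.mul (hc.pow 2).measurable).aestronglyMeasurable
      (h_ae fun x hx => ?_)).congr (.of_forall fun x => by simp only; ring)
    rw [norm_mul, norm_of_nonneg (sq_nonneg (v x))]
    exact mul_le_mul (hT_abs x (le_of_lt hx)) (hB x hx) (sq_nonneg _)
      ((abs_nonneg _).trans (hT_abs x (le_of_lt hx)))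
  have h_six_T : IntegrableOn (fun x => T x ^ 2 * v x ^ 6) (Ioi 0) := by
    refine h_six.bdd_mul (c := tan (k * M) ^ 2) (hT_meas.pow_const 2).aestronglyMeasurable
      (h_ae fun x hx => ?_)
    rw [norm_of_nonneg (sq_nonneg _)]
    exact pow_le_pow_left₀ (hT0 x (le_of_lt hx)) (hT_le x (le_of_lt hx)) 2
  set F' : ℝ → ℝ := fun x =>
    4 * k * (T x * (v x ^ 3 * v' x)) + k ^ 2 * (v x ^ 6 + T x ^ 2 * v x ^ 6) with hF'
  have hF'_int : IntegrableOn F' (Ioi 0) :=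
    (h_cross.const_mul (4 * k)).add ((h_six.add h_six_T).const_mul (k ^ 2))
  have hF_lim : Tendsto (fun x => k * (T x * v x ^ 4)) atTop (nhds 0) := by
    have h_four : Tendsto (fun x => k * (tan (k * M) * (v x ^ 2) ^ 2)) atTop (nhds 0) := by
      simpa using ((hlim.pow 2).const_mul (tan (k * M))).const_mul k
    refine squeeze_zero' ?_ ?_ h_four
    · filter_upwards [eventually_ge_atTop 0] with x hx
      have := hT0 x hx
      positivity
    · filter_upwards [eventually_ge_atTop 0] with x hx
      rw [← pow_mul]
      have := hT_le x hx
      gcongr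
  have hF_zero : ∫ x in Ioi (0 : ℝ), F' x = 0 := by
    rw [integral_Ioi_of_hasDerivAt_of_tendsto (f := fun x => k * (T x * v x ^ 4))
      (m := 0) ?_ (fun x hx => ?_) hF'_int hF_lim]
    · simp [hT, hS]
    · exact (continuousAt_const.mul ((hT_deriv 0 le_rfl).continuousAt.mul
        (hc.pow 4).continuousAt)).continuousWithinAt
    · refine (((hT_deriv x (le_of_lt hx)).mul ((hd x hx).pow 4)).const_mul k).congr_deriv ?_
      simp only [hF', Pi.pow_apply]
      push_cast
      ring
  calc k ^ 2 * ∫ x in Ioi (0 : ℝ), v x ^ 6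
      = ∫ x in Ioi (0 : ℝ), k ^ 2 * v x ^ 6 := (integral_const_mul _ _).symm
    _ ≤ ∫ x in Ioi (0 : ℝ), (4 * v' x ^ 2 + F' x) := by
        refine integral_mono (h_six.const_mul _) ((hv'.const_mul 4).add hF'_int) fun x => ?_
        simp only [hF']
        linear_combination sq_nonneg (2 * v' x + k * T x * v x ^ 3)
    _ = 4 * ∫ x in Ioi (0 : ℝ), v' x ^ 2 := by
        rw [integral_add (hv'.const_mul 4) hF'_int, hF_zero, integral_const_mul, add_zero]

lemma integral_pow_six_le (hc : Continuous v)
    (hd : ∀ x ∈ Ioi (0 : ℝ), HasDerivAt v (v' x) x)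
    (hv : IntegrableOn (fun x => v x ^ 2) (Ioi 0))
    (hv' : IntegrableOn (fun x => v' x ^ 2) (Ioi 0)) :
    ∫ x in Ioi (0 : ℝ), v x ^ 6 ≤
      16 / π ^ 2 * (∫ x in Ioi (0 : ℝ), v x ^ 2) ^ 2 * ∫ x in Ioi (0 : ℝ), v' x ^ 2 := by
  set M := ∫ x in Ioi (0 : ℝ), v x ^ 2 with hM
  have hM0 : 0 ≤ M := integral_nonneg fun x => sq_nonneg _
  have h_bound (m : ℝ) (hm : m ∈ Ioi M) :
      ∫ x in Ioi (0 : ℝ), v x ^ 6 ≤ 16 / π ^ 2 * m ^ 2 * ∫ x in Ioi (0 : ℝ), v' x ^ 2 := by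
    have hm0 : 0 < m := hM0.trans_lt hm
    have hkM : π / (2 * m) * M < π / 2 := by
      rw [div_mul_eq_mul_div, div_lt_div_iff₀ (by positivity) two_pos]
      nlinarith [mul_lt_mul_of_pos_left (mem_Ioi.1 hm) pi_pos]
    have h := sq_mul_integral_pow_six_le hc hd hv hv' (k := π / (2 * m)) (by positivity) hkM
    have hk2 : 0 < (π / (2 * m)) ^ 2 := by positivity
    refine ((le_div_iff₀' hk2).2 h).trans_eq ?_
    field_simp
    ring
  refine ge_of_tendsto (f := fun m : ℝ => 16 / π ^ 2 * m ^ 2 * ∫ x in Ioi (0 : ℝ), v' x ^ 2)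
    (x := nhdsWithin M (Ioi M)) ?_ (eventually_mem_nhdsWithin.mono h_bound)
  exact ((by fun_prop : Continuous fun m : ℝ =>
    16 / π ^ 2 * m ^ 2 * ∫ x in Ioi (0 : ℝ), v' x ^ 2).tendsto M).mono_left nhdsWithin_le_nhds

end HalfLine

/-- Sharp Gagliardo–Nirenberg inequality on the half-line with critical exponent 6:
for every `u ∈ H¹(ℝ⁺)`, `∫₀^∞ |u|⁶ ≤ (16/π²) (∫₀^∞ u²)² (∫₀^∞ |u'|²)`. -/
theorem sharp_gagliardo_nirenberg_halfline (u u' : ℝ → ℝ) (h : H1halfline u u') :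
    (∫ x in Set.Ioi (0 : ℝ), |u x| ^ 6) ≤
      16 / Real.pi ^ 2 * (∫ x in Set.Ioi (0 : ℝ), (u x) ^ 2) ^ 2 *
        ∫ x in Set.Ioi (0 : ℝ), (u' x) ^ 2 := by
  obtain ⟨hc, hd, hu, hu'⟩ := h
  have h_eq : EqOn (fun x => u (max x 0)) u (Ioi 0) := fun x hx => by
    simp [max_eq_left (le_of_lt (mem_Ioi.1 hx))]
  have h_pow (n : ℕ) : EqOn (fun x => u (max x 0) ^ n) (fun x => u x ^ n) (Ioi 0) :=
    fun x hx => congrArg (· ^ n) (h_eq hx)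
  have key := integral_pow_six_le (v := fun x => u (max x 0)) (v' := u')
    (hc.comp_continuous (by fun_prop) fun x => le_max_right x 0)
    (fun x hx => (hd x hx).congr_of_eventuallyEq (h_eq.eventuallyEq_of_mem (Ioi_mem_nhds hx)))
    (hu.congr_fun (h_pow 2).symm measurableSet_Ioi) hu'
  rw [setIntegral_congr_fun measurableSet_Ioi (h_pow 6),
    setIntegral_congr_fun measurableSet_Ioi (h_pow 2)] at key
  simpa only [Even.pow_abs (by decide : Even 6)] using key
end

section
/- For the homogeneous critical NLS energy E₀(u) = ∫_ℝ (½|u'|² − (1/6)|u|⁶) dx on the line, if μ > μ_ℝ then the energy is unbounded from below on H¹_μ(ℝ): for every M > 0 there exists u ∈ H¹_μ(ℝ) with E₀(u) < −M. -/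
open MeasureTheory Real Set Filter

/-- The homogeneous critical NLS energy `E₀(u) = ∫_ℝ (½|u'|² − (1/6)|u|⁶)`. -/
noncomputable def E0line (u u' : ℝ → ℝ) : ℝ :=
  ∫ x, (1 / 2 * (u' x) ^ 2 - 1 / 6 * |u x| ^ 6)

open scoped Topology

theorem abs_le_abs_sinh (x : ℝ) : |x| ≤ |sinh x| := by
  rw [abs_sinh]
  exact self_le_sinh_iff.2 (abs_nonneg x)

theorem abs_sinh_le_cosh (x : ℝ) : |sinh x| ≤ cosh x :=
  abs_le_of_sq_le_sq (by rw [cosh_sq]; linarith) (cosh_pos x).le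

theorem one_add_sq_le_two_mul_cosh (x : ℝ) : 1 + x ^ 2 ≤ 2 * cosh x := by
  have h1 : cosh x = 1 + 2 * sinh (x / 2) ^ 2 := by
    have h := cosh_two_mul (x / 2)
    rw [mul_div_cancel₀ x two_ne_zero, cosh_sq] at h
    linarith
  have h2 := sq_le_sq.2 (abs_le_abs_sinh (x / 2))
  nlinarith

theorem integrable_inv_cosh : Integrable fun x : ℝ => (cosh x)⁻¹ := by
  refine (integrable_inv_one_add_sq.const_mul 2).mono'
    (continuous_cosh.inv₀ fun x => (cosh_pos x).ne').aestronglyMeasurable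
    (Eventually.of_forall fun x => ?_)
  have h := one_add_sq_le_two_mul_cosh x
  have hx : 0 < 1 + x ^ 2 := by positivity
  have hc := cosh_pos x
  rw [norm_of_nonneg (inv_pos.2 hc).le, ← div_eq_mul_inv, inv_eq_one_div, div_le_div_iff₀ hc hx]
  linarith

theorem integrable_inv_cosh_pow_three : Integrable fun x : ℝ => (cosh x)⁻¹ ^ 3 := by
  refine integrable_inv_cosh.mono'
    ((continuous_cosh.inv₀ fun x => (cosh_pos x).ne').pow 3).aestronglyMeasurable
    (Eventually.of_forall fun x => ?_)
  have h0 : 0 ≤ (cosh x)⁻¹ := (inv_pos.2 (cosh_pos x)).le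
  rw [norm_of_nonneg (pow_nonneg h0 3)]
  exact pow_le_of_le_one h0 (inv_le_one_of_one_le₀ (one_le_cosh x)) three_ne_zero

theorem tendsto_arctan_sinh_atTop : Tendsto (fun x : ℝ => arctan (sinh x)) atTop (𝓝 (π / 2)) := by
  refine (tendsto_arctan_atTop.mono_right nhdsWithin_le_nhds).comp
    (tendsto_atTop_mono' _ ?_ tendsto_id)
  filter_upwards [eventually_ge_atTop 0] with x hx using self_le_sinh_iff.2 hx

theorem tendsto_arctan_sinh_atBot :
    Tendsto (fun x : ℝ => arctan (sinh x)) atBot (𝓝 (-(π / 2))) := by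
  have h := (tendsto_arctan_sinh_atTop.comp tendsto_neg_atBot_atTop).neg
  simpa [Function.comp_def] using h

theorem hasDerivAt_arctan_sinh (x : ℝ) :
    HasDerivAt (fun x : ℝ => arctan (sinh x)) (cosh x)⁻¹ x := by
  convert (hasDerivAt_sinh x).arctan using 1
  have hc := (cosh_pos x).ne'
  rw [add_comm, ← cosh_sq]
  field_simp

theorem integral_inv_cosh : ∫ x : ℝ, (cosh x)⁻¹ = π := by
  rw [integral_of_hasDerivAt_of_tendsto hasDerivAt_arctan_sinh integrable_inv_cosh
    tendsto_arctan_sinh_atBot tendsto_arctan_sinh_atTop]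
  ring

theorem tendsto_sinh_div_cosh_sq {l : Filter ℝ} (hl : Tendsto (fun x : ℝ => |x|) l atTop) :
    Tendsto (fun x : ℝ => sinh x / cosh x ^ 2) l (𝓝 0) := by
  refine squeeze_zero_norm (fun x => ?_) (tendsto_inv_atTop_zero.comp
    (tendsto_atTop_mono (fun x => (abs_le_abs_sinh x).trans (abs_sinh_le_cosh x)) hl))
  have hc := cosh_pos x
  rw [norm_div, norm_of_nonneg (sq_nonneg (cosh x)), Real.norm_eq_abs, Function.comp_apply,
    div_le_iff₀ (by positivity)]
  calc |sinh x| ≤ cosh x := abs_sinh_le_cosh x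
    _ = (cosh x)⁻¹ * cosh x ^ 2 := by field_simp

theorem integral_inv_cosh_pow_three : ∫ x : ℝ, (cosh x)⁻¹ ^ 3 = π / 2 := by
  have hd (x : ℝ) : HasDerivAt (fun x : ℝ => 1 / 2 * (sinh x / cosh x ^ 2 + arctan (sinh x)))
      ((cosh x)⁻¹ ^ 3) x := by
    have hc := (cosh_pos x).ne'
    have h := (((hasDerivAt_sinh x).div ((hasDerivAt_cosh x).pow 2) (pow_ne_zero 2 hc)).add
      (hasDerivAt_arctan_sinh x)).const_mul (1 / 2)
    convert! h using 1
    have hs := sinh_sq x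
    simp only [Pi.pow_apply, Nat.cast_ofNat]
    field_simp
    linear_combination 2 * cosh x * hs
  rw [integral_of_hasDerivAt_of_tendsto hd integrable_inv_cosh_pow_three
    (((tendsto_sinh_div_cosh_sq tendsto_abs_atBot_atTop).add tendsto_arctan_sinh_atBot).const_mul _)
    (((tendsto_sinh_div_cosh_sq tendsto_abs_atTop_atTop).add
      tendsto_arctan_sinh_atTop).const_mul _)]
  ring

/-- The mass-preserving dilation by `l` of the critical soliton, with squared amplitude `c`. -/
noncomputable def soliton (c l x : ℝ) : ℝ := √(c * l) * (√(cosh (l * x)))⁻¹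

/-- The derivative of `soliton c l`. -/
noncomputable def solitonDeriv (c l x : ℝ) : ℝ :=
  -(l / 2) * (sinh (l * x) / cosh (l * x)) * soliton c l x

theorem soliton_sq {c l : ℝ} (hc : 0 ≤ c) (hl : 0 ≤ l) (x : ℝ) :
    soliton c l x ^ 2 = c * l * (cosh (l * x))⁻¹ := by
  rw [soliton, mul_pow, inv_pow, sq_sqrt (mul_nonneg hc hl), sq_sqrt (cosh_pos _).le]

theorem solitonDeriv_sq {c l : ℝ} (hc : 0 ≤ c) (hl : 0 ≤ l) (x : ℝ) :
    solitonDeriv c l x ^ 2 =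
      c * l ^ 3 / 4 * ((cosh (l * x))⁻¹ - (cosh (l * x))⁻¹ ^ 3) := by
  rw [solitonDeriv, mul_pow, soliton_sq hc hl, mul_pow, div_pow, sinh_sq]
  have h := (cosh_pos (l * x)).ne'
  field_simp
  ring

theorem hasDerivAt_soliton (c l x : ℝ) :
    HasDerivAt (soliton c l) (solitonDeriv c l x) x := by
  have hp := cosh_pos (l * x)
  have h := (((((hasDerivAt_id x).const_mul l).cosh).sqrt hp.ne').inv
    (sqrt_pos.2 hp).ne').const_mul (√(c * l))
  convert! h using 1
  rw [solitonDeriv, soliton, id, sq_sqrt hp.le]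
  field_simp

theorem H1line_soliton {c l : ℝ} (hc : 0 ≤ c) (hl : 0 < l) :
    H1line (soliton c l) (solitonDeriv c l) := by
  refine ⟨hasDerivAt_soliton c l, ?_, ?_⟩
  · simp only [soliton_sq hc hl.le]
    exact (integrable_inv_cosh.comp_mul_left' hl.ne').const_mul _
  · simp only [solitonDeriv_sq hc hl.le]
    exact ((integrable_inv_cosh.sub integrable_inv_cosh_pow_three).comp_mul_left'
      hl.ne').const_mul _

theorem integral_soliton_sq {c l : ℝ} (hc : 0 ≤ c) (hl : 0 < l) :
    ∫ x, soliton c l x ^ 2 = c * π := by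
  simp only [soliton_sq hc hl.le]
  rw [integral_const_mul, Measure.integral_comp_mul_left (fun y => (cosh y)⁻¹), integral_inv_cosh,
    abs_of_pos (inv_pos.2 hl), smul_eq_mul]
  field_simp

theorem E0line_soliton {c l : ℝ} (hc : 0 ≤ c) (hl : 0 < l) :
    E0line (soliton c l) (solitonDeriv c l) = -(c * π / 12 * (c ^ 2 - 3 / 4)) * l ^ 2 := by
  have h (x : ℝ) : 1 / 2 * solitonDeriv c l x ^ 2 - 1 / 6 * |soliton c l x| ^ 6 =
      c * l ^ 3 / 8 * (cosh (l * x))⁻¹ -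
        (c * l ^ 3 / 8 + c ^ 3 * l ^ 3 / 6) * (cosh (l * x))⁻¹ ^ 3 := by
    rw [show |soliton c l x| ^ 6 = (|soliton c l x| ^ 2) ^ 3 by ring, sq_abs, soliton_sq hc hl.le,
      solitonDeriv_sq hc hl.le]
    ring
  simp only [E0line, h]
  rw [Measure.integral_comp_mul_left (fun y => c * l ^ 3 / 8 * (cosh y)⁻¹ -
      (c * l ^ 3 / 8 + c ^ 3 * l ^ 3 / 6) * (cosh y)⁻¹ ^ 3),
    integral_sub (integrable_inv_cosh.const_mul _) (integrable_inv_cosh_pow_three.const_mul _),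
    integral_const_mul, integral_const_mul, integral_inv_cosh, integral_inv_cosh_pow_three,
    abs_of_pos (inv_pos.2 hl), smul_eq_mul]
  field_simp
  ring

/-- For the homogeneous critical NLS energy on the line, if `μ > μ_ℝ` then the energy
is unbounded from below on `H¹_μ(ℝ)`: for every `M > 0` there exists `u ∈ H¹_μ(ℝ)`
with `E₀(u) < −M`. -/
theorem critical_energy_unbounded_line (μ : ℝ) (hμ : Real.pi * Real.sqrt 3 / 2 < μ) :
    ∀ M : ℝ, 0 < M → ∃ u u' : ℝ → ℝ,
      H1line u u' ∧ (∫ x, (u x) ^ 2) = μ ∧ E0line u u' < -M := by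
  intro M hM
  obtain ⟨c, rfl⟩ : ∃ c, μ = c * π := ⟨μ / π, by field_simp⟩
  have hc : √3 / 2 < c := by
    refine lt_of_mul_lt_mul_right ?_ pi_pos.le
    linarith
  have hc0 : 0 < c := lt_of_le_of_lt (by positivity) hc
  have hc2 : 3 / 4 < c ^ 2 := by
    have h := pow_lt_pow_left₀ hc (by positivity) two_ne_zero
    rw [div_pow, sq_sqrt (by norm_num)] at h
    linarith
  set K := c * π / 12 * (c ^ 2 - 3 / 4) with hK
  have hK0 : 0 < K := mul_pos (by positivity) (by linarith)
  have hl : 0 < M / K + 1 := by positivity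
  refine ⟨soliton c (M / K + 1), solitonDeriv c (M / K + 1), H1line_soliton hc0.le hl,
    integral_soliton_sq hc0.le hl, ?_⟩
  rw [E0line_soliton hc0.le hl, ← hK, neg_mul, neg_lt_neg_iff]
  have h1 : M / K + 1 ≤ (M / K + 1) ^ 2 :=
    le_self_pow₀ (le_add_of_nonneg_left (by positivity)) two_ne_zero
  calc M < K * (M / K + 1) := by field_simp; linarith
    _ ≤ K * (M / K + 1) ^ 2 := mul_le_mul_of_nonneg_left h1 hK0.le
end
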